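/- arXiv:1203.0801 — 3 statements merged into one kernel-verified Lean document; each statement's English description precedes it below -/
import Mathlib

section
/- Let D = ℝ × (−π, 0) and let Λ be the measure on D with density (x, α) ↦ −sin α with respect to two-dimensional Lebesgue measure. Let (K_n) be a sequence of measurable maps K_n : D → D, each a measure-preserving involution for Λ (K_n ∘ K_n = id and Λ(K_n⁻¹(A)) = Λ(A) for all measurable A). Let P be a Markov kernel on D and suppose that for all continuous compactly supported f, g : D → ℝ, ∫_D f(K_n(z)) g(z) dΛ(z) → ∫_D (∫_D f(w) P(z; dw)) g(z) dΛ(z) as n → ∞. Then P is symmetric with respect to Λ: for all continuous compactly supported f, g : D → ℝ, ∫_D (∫_D f(w) P(z; dw)) g(z) dΛ(z) = ∫_D (∫_D g(w) P(z; dw)) f(z) dΛ(z); moreover, Λ is invariant for P: for every nonnegative continuous compactly supported f : D → ℝ, ∫_D (∫_D f(w) P(z; dw)) dΛ(z) = ∫_D f(z) dΛ(z). -/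
open MeasureTheory ProbabilityTheory Filter

noncomputable section

/-- The angle space `(−π, 0)`. -/
abbrev Angle : Type := ↥(Set.Ioo (-Real.pi) (0 : ℝ))

/-- The phase space `D = ℝ × (−π, 0)` of rays crossing the line `L_*`. -/
abbrev D : Type := ℝ × Angle

/-- Lebesgue measure on the interval `(−π, 0)`. -/
def lebAngle : Measure Angle := Measure.comap Subtype.val volume

/-- The measure `Λ` on `D = ℝ × (−π, 0)` with density `(x, α) ↦ −sin α` with respect to
two-dimensional Lebesgue measure. -/
def lambdaMeasure : Measure D :=
  ((volume : Measure ℝ).prod lebAngle).withDensity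
    fun p => ENNReal.ofReal (-Real.sin (p.2 : ℝ))

instance lebAngle_finite : IsFiniteMeasure lebAngle := by
  constructor
  rw [lebAngle, comap_subtype_coe_apply measurableSet_Ioo]
  rw [Set.image_univ, Subtype.range_coe, Real.volume_Ioo]
  exact ENNReal.ofReal_lt_top

instance lambda_fmoc : IsFiniteMeasureOnCompacts lambdaMeasure := by
  have hle : lambdaMeasure ≤ (volume : Measure ℝ).prod lebAngle := by
    have h : lambdaMeasure ≤ ((volume : Measure ℝ).prod lebAngle).withDensity 1 := by
      apply withDensity_mono
      refine Eventually.of_forall fun p => ?_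
      rw [Pi.one_apply, ENNReal.ofReal_le_one]
      linarith [Real.neg_one_le_sin (p.2 : ℝ)]
    simpa using h
  exact ⟨fun C hC => (hle C).trans_lt hC.measure_lt_top⟩

instance angle_lc : LocallyCompactSpace Angle := isOpen_Ioo.locallyCompactSpace

theorem exists_cutoff : ∃ g : ℕ → D → ℝ, (∀ n, Continuous (g n)) ∧
    (∀ n, HasCompactSupport (g n)) ∧ (∀ n z, 0 ≤ g n z) ∧ (∀ n z, g n z ≤ 1) ∧
    (∀ z, Monotone fun n => g n z) ∧ (∀ z, Tendsto (fun n => g n z) atTop (nhds 1)) := by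
  let E : CompactExhaustion D := CompactExhaustion.choice D
  have h := fun n => exists_continuous_one_zero_of_isCompact (E.isCompact n)
    (isOpen_interior (s := E (n+1))).isClosed_compl
    (Set.disjoint_compl_right_iff_subset.mpr (E.subset_interior_succ n))
  choose g h1 h0 hc hI using h
  refine ⟨fun n => g n, fun n => (g n).continuous, hc, fun n z => (hI n z).1,
    fun n z => (hI n z).2, fun z => monotone_nat_of_le_succ fun n => ?_, fun z => ?_⟩
  · change g n z ≤ g (n+1) z
    by_cases hz : z ∈ E (n+1)
    · rw [h1 (n+1) hz]; exact (hI n z).2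
    · rw [h0 n (fun h => hz (interior_subset h))]; exact (hI (n+1) z).1
  · obtain ⟨N, hN⟩ := E.exists_mem z
    refine tendsto_const_nhds.congr' ?_
    filter_upwards [eventually_ge_atTop N] with n hn
    exact (h1 n (E.subset hn hN)).symm

theorem invariant_of_symm (P : Kernel D D) [IsMarkovKernel P]
    (hs : ∀ f g : D → ℝ, Continuous f → HasCompactSupport f →
        Continuous g → HasCompactSupport g →
        ∫ z, (∫ w, f w ∂(P z)) * g z ∂lambdaMeasure
          = ∫ z, (∫ w, g w ∂(P z)) * f z ∂lambdaMeasure)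
    (f : D → ℝ) (hf : Continuous f) (hfc : HasCompactSupport f) (h0 : ∀ z, 0 ≤ f z) :
    ∫ z, (∫ w, f w ∂(P z)) ∂lambdaMeasure = ∫ z, f z ∂lambdaMeasure := by
  obtain ⟨g, gc, gs, g0, g1, gm, gt⟩ := exists_cutoff
  have hfi : Integrable f lambdaMeasure := hf.integrable_of_hasCompactSupport hfc
  have hmeas : ∀ u : D → ℝ, Continuous u → StronglyMeasurable fun z => ∫ w, u w ∂(P z) :=
    fun u hu => hu.stronglyMeasurable.integral_kernel
  have hF0 : ∀ z, 0 ≤ ∫ w, f w ∂(P z) := fun z => integral_nonneg h0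
  obtain ⟨C, hC⟩ := hfc.exists_bound_of_continuous hf
  have hFC : ∀ z, ‖∫ w, f w ∂(P z)‖ ≤ C := fun z => by
    simpa using norm_integral_le_of_norm_le_const (μ := P z) (Eventually.of_forall hC)
  have hPg0 : ∀ n z, 0 ≤ ∫ w, g n w ∂(P z) := fun n z => integral_nonneg (g0 n)
  have hgn : ∀ n z, ‖g n z‖ ≤ 1 := fun n z => by
    rw [Real.norm_of_nonneg (g0 n z)]; exact g1 n z
  have hPg1 : ∀ n z, ‖∫ w, g n w ∂(P z)‖ ≤ 1 := fun n z => by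
    simpa using norm_integral_le_of_norm_le_const (μ := P z) (Eventually.of_forall (hgn n))
  have hPgt : ∀ z, Tendsto (fun n => ∫ w, g n w ∂(P z)) atTop (nhds 1) := fun z => by
    have := tendsto_integral_of_dominated_convergence (μ := P z) (F := g) (f := fun _ => (1:ℝ))
      (fun _ => 1) (fun n => (gc n).aestronglyMeasurable) (integrable_const _)
      (fun n => Eventually.of_forall (hgn n)) (Eventually.of_forall gt)
    simpa using this
  have hR : Tendsto (fun n => ∫ z, (∫ w, g n w ∂(P z)) * f z ∂lambdaMeasure) atTop
      (nhds (∫ z, f z ∂lambdaMeasure)) := by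
    refine tendsto_integral_of_dominated_convergence (fun z => ‖f z‖)
      (fun n => (hmeas _ (gc n)).aestronglyMeasurable.mul hf.aestronglyMeasurable) hfi.norm
      (fun n => Eventually.of_forall fun z => ?_) (Eventually.of_forall fun z => ?_)
    · rw [norm_mul]
      exact mul_le_of_le_one_left (norm_nonneg _) (hPg1 n z)
    · simpa using (hPgt z).mul_const (f z)
  have hL : Tendsto (fun n => ∫⁻ z, ENNReal.ofReal ((∫ w, f w ∂(P z)) * g n z) ∂lambdaMeasure)
      atTop (nhds (∫⁻ z, ENNReal.ofReal (∫ w, f w ∂(P z)) ∂lambdaMeasure)) := by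
    refine lintegral_tendsto_of_tendsto_of_monotone
      (fun n => ((hmeas f hf).measurable.mul (gc n).measurable).ennreal_ofReal.aemeasurable)
      (Eventually.of_forall fun z n m hnm => ?_) (Eventually.of_forall fun z => ?_)
    · exact ENNReal.ofReal_le_ofReal (mul_le_mul_of_nonneg_left (gm z hnm) (hF0 z))
    · refine ENNReal.tendsto_ofReal ?_
      simpa using (gt z).const_mul (∫ w, f w ∂(P z))
  have hE : ∀ n, ∫⁻ z, ENNReal.ofReal ((∫ w, f w ∂(P z)) * g n z) ∂lambdaMeasure
      = ENNReal.ofReal (∫ z, (∫ w, g n w ∂(P z)) * f z ∂lambdaMeasure) := fun n => by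
    rw [← hs f (g n) hf hfc (gc n) (gs n), ofReal_integral_eq_lintegral_ofReal]
    · exact ((gc n).integrable_of_hasCompactSupport (gs n)).bdd_mul
        (hmeas f hf).aestronglyMeasurable (Eventually.of_forall hFC)
    · exact Eventually.of_forall fun z => mul_nonneg (hF0 z) (g0 n z)
  simp only [hE] at hL
  have := tendsto_nhds_unique hL (ENNReal.tendsto_ofReal hR)
  rw [integral_eq_lintegral_of_nonneg_ae (Eventually.of_forall hF0)
    (hmeas f hf).aestronglyMeasurable, this, ENNReal.toReal_ofReal (integral_nonneg h0)]

/-- Theorem 2.2(ii): if deterministic reflectors `K n` (measure-preserving involutions of `Λ`)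
converge weakly to a Markov kernel `P`, then `P` is symmetric with respect to `Λ` and `Λ`
is invariant for `P`. -/
theorem kernel_symm_of_tendsto_involutions
    (K : ℕ → D → D) (hKmeas : ∀ n, Measurable (K n))
    (hKinvol : ∀ n, K n ∘ K n = id)
    (hKpres : ∀ n, ∀ A : Set D, MeasurableSet A →
      lambdaMeasure ((K n) ⁻¹' A) = lambdaMeasure A)
    (P : Kernel D D) [IsMarkovKernel P]
    (hconv : ∀ f g : D → ℝ, Continuous f → HasCompactSupport f →
      Continuous g → HasCompactSupport g →
      Tendsto (fun n => ∫ z, f (K n z) * g z ∂lambdaMeasure) atTop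
        (nhds (∫ z, (∫ w, f w ∂(P z)) * g z ∂lambdaMeasure))) :
    (∀ f g : D → ℝ, Continuous f → HasCompactSupport f →
        Continuous g → HasCompactSupport g →
        ∫ z, (∫ w, f w ∂(P z)) * g z ∂lambdaMeasure
          = ∫ z, (∫ w, g w ∂(P z)) * f z ∂lambdaMeasure) ∧
    (∀ f : D → ℝ, Continuous f → HasCompactSupport f → (∀ z, 0 ≤ f z) →
        ∫ z, (∫ w, f w ∂(P z)) ∂lambdaMeasure = ∫ z, f z ∂lambdaMeasure) := by
  have hsymm : ∀ f g : D → ℝ, Continuous f → HasCompactSupport f →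
        Continuous g → HasCompactSupport g →
        ∫ z, (∫ w, f w ∂(P z)) * g z ∂lambdaMeasure
          = ∫ z, (∫ w, g w ∂(P z)) * f z ∂lambdaMeasure := by
    intro f g hf hfc hg hgc
    refine tendsto_nhds_unique (hconv f g hf hfc hg hgc) ?_
    refine (hconv g f hg hgc hf hfc).congr fun n => ?_
    have hmp : MeasurePreserving (K n) lambdaMeasure lambdaMeasure :=
      ⟨hKmeas n, Measure.ext fun A hA => by
        rw [Measure.map_apply (hKmeas n) hA, hKpres n A hA]⟩
    have hKK : ∀ z, K n (K n z) = z := fun z => congrFun (hKinvol n) z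
    have h := integral_map (μ := lambdaMeasure) (hKmeas n).aemeasurable
      (f := fun z => f (K n z) * g z)
      ((hf.measurable.comp (hKmeas n)).mul hg.measurable).aestronglyMeasurable
    rw [hmp.map_eq] at h
    rw [h]
    simp only [hKK]
    exact integral_congr_ae (Eventually.of_forall fun z => mul_comm _ _)
  exact ⟨hsymm, fun f hf hfc h0 => invariant_of_symm P hsymm f hf hfc h0⟩

end
end

section
/- Let D = ℝ × (−π, 0), let Λ be the measure on D with density (x, α) ↦ −sin α with respect to two-dimensional Lebesgue measure, and let ν be the measure on (−π, 0) with density α ↦ −sin α. Let P̃ be a Markov kernel from ℝ × (−π, 0) to (−π, 0), and define the Markov kernel P on D by P((x, α); ·) = δ_x ⊗ P̃((x, α); ·), i.e., P((x, α); ·) is the law of (x, β) where β has law P̃((x, α); ·). If P is symmetric with respect to Λ, in the sense that for all continuous compactly supported f, g : D → ℝ, ∫_D (∫_D f(w) P(z; dw)) g(z) dΛ(z) = ∫_D (∫_D g(w) P(z; dw)) f(z) dΛ(z), then for Lebesgue-almost every x ∈ ℝ, the kernel α ↦ P̃((x, α); ·) is symmetric with respect to ν: the measure on (−π, 0)² given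 by ∫ (δ_α ⊗ P̃((x, α); ·)) dν(α) is invariant under the coordinate swap (α, β) ↦ (β, α). -/
open MeasureTheory ProbabilityTheory

noncomputable section

/-- The measure `ν` on `(−π, 0)` with density `α ↦ −sin α` with respect to Lebesgue measure. -/
def nuMeasure : Measure Angle :=
  lebAngle.withDensity fun α => ENNReal.ofReal (-Real.sin (α : ℝ))

/-- The measure `∫ (δ_α ⊗ P̃((x, α); ·)) dν(α)` on `(−π, 0)²` associated with the angular
kernel `P̃` at the point `x ∈ ℝ`. -/
def angularJoint (Ptilde : Kernel D Angle) (x : ℝ) : Measure (Angle × Angle) :=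
  nuMeasure.bind fun α => (Measure.dirac α).prod (Ptilde (x, α))

lemma aux_ae_eq {X Y : Type*} [MeasurableSpace X] [MeasurableSpace Y]
    [MeasurableSpace.CountableOrCountablyGenerated X Y]
    (μ : Measure X) [SigmaFinite μ] (κ η : Kernel X Y) [IsFiniteKernel κ] [IsFiniteKernel η]
    (h : μ ⊗ₘ κ = μ ⊗ₘ η) : ∀ᵐ x ∂μ, κ x = η x := by
  have key : ∀ n, ∀ᵐ x ∂(μ.restrict (spanningSets μ n)), κ x = η x := by
    intro n
    have : IsFiniteMeasure (μ.restrict (spanningSets μ n)) :=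
      ⟨by simpa using measure_spanningSets_lt_top μ n⟩
    refine Kernel.ae_eq_of_compProd_eq ?_
    refine Measure.ext_prod ?_
    intro s t hs ht
    have hS := measurableSet_spanningSets μ n
    have := congrArg (fun m => m ((s ∩ spanningSets μ n) ×ˢ t)) h
    simp only [Measure.compProd_apply_prod (hs.inter hS) ht] at this
    rw [Measure.compProd_apply_prod hs ht, Measure.compProd_apply_prod hs ht,
      Measure.restrict_restrict hs]
    exact this
  have := (ae_restrict_iUnion_iff (μ := μ) (spanningSets μ) (fun x => κ x = η x)).2 key
  rwa [iUnion_spanningSets, Measure.restrict_univ] at this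

lemma aux_swap {X : Type*} [TopologicalSpace X] [MeasurableSpace X] [BorelSpace X]
    [TopologicalSpace.PseudoMetrizableSpace X] [T2Space X]
    [SecondCountableTopology X] [LocallyCompactSpace X]
    (J : Measure (X × X))
    (hint : ∀ f : X → ℝ, Continuous f → HasCompactSupport f → Integrable (fun p => f p.1) J)
    (hsym : ∀ f g : X → ℝ, Continuous f → HasCompactSupport f →
      Continuous g → HasCompactSupport g →
      ∫ p, f p.2 * g p.1 ∂J = ∫ p, g p.2 * f p.1 ∂J) :
    J.map Prod.swap = J := by
  have hcov : ⋃ n, (compactCovering X n ×ˢ compactCovering X n) = Set.univ := by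
    ext ⟨a, b⟩
    obtain ⟨n, hn⟩ := Set.mem_iUnion.1 ((iUnion_compactCovering X).symm ▸ Set.mem_univ a)
    obtain ⟨m, hm⟩ := Set.mem_iUnion.1 ((iUnion_compactCovering X).symm ▸ Set.mem_univ b)
    simp only [Set.mem_iUnion, Set.mem_univ, iff_true]
    exact ⟨max n m, compactCovering_subset X (le_max_left _ _) hn,
      compactCovering_subset X (le_max_right _ _) hm⟩
  refine Measure.ext_of_iUnion_eq_univ hcov ?_
  intro n
  set K := compactCovering X n
  have hK : IsCompact K := isCompact_compactCovering X n
  obtain ⟨χ, hχ1, hχc, -, hχ01⟩ :=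
    exists_continuousMap_one_of_isCompact_subset_isOpen hK isOpen_univ (Set.subset_univ _)
  have hχc' : HasCompactSupport χ := hχc
  have hχm : Measurable χ := χ.continuous.measurable
  set S := K ×ˢ K
  have hS : MeasurableSet S := hK.measurableSet.prod hK.measurableSet
  set d : X × X → ENNReal := fun p => ENNReal.ofReal (χ p.1 * χ p.2)
  have hd : Measurable d := by fun_prop
  set Jχ := J.withDensity d with hJχ
  have : IsFiniteMeasure Jχ := by
    refine isFiniteMeasure_withDensity_ofReal ?_
    refine Integrable.hasFiniteIntegral ?_
    refine ((hint χ χ.continuous hχc').norm).mono' (by fun_prop) (ae_of_all _ fun p => ?_)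
    rw [norm_mul]
    refine mul_le_of_le_one_right (norm_nonneg _) ?_
    rw [Real.norm_of_nonneg (hχ01 _).1]
    exact (hχ01 _).2
  have hswap : Jχ.map Prod.swap = Jχ := by
    have : IsFiniteMeasure (Jχ.map Prod.swap) := inferInstance
    refine Measure.ext_of_integral_mul_boundedContinuousFunction fun f g => ?_
    have e : ∀ F : X × X → ℝ, ∫ p, F p ∂Jχ = ∫ p, (χ p.1 * χ p.2) * F p ∂J := by
      intro F
      rw [hJχ, integral_withDensity_eq_integral_toReal_smul hd
        (ae_of_all _ fun p => ENNReal.ofReal_lt_top)]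
      refine integral_congr_ae (ae_of_all _ fun p => ?_)
      simp only [d, smul_eq_mul]
      rw [ENNReal.toReal_ofReal (mul_nonneg (hχ01 _).1 (hχ01 _).1)]
    rw [integral_map measurable_swap.aemeasurable
      (by fun_prop : Continuous fun p : X × X => f p.1 * g p.2).aestronglyMeasurable, e, e]
    have := hsym (fun x => χ x * f x) (fun x => χ x * g x) (by fun_prop) hχc'.mul_right
      (by fun_prop) hχc'.mul_right
    calc _ = ∫ p : X × X, χ p.2 * f p.2 * (χ p.1 * g p.1) ∂J := by
          refine integral_congr_ae (ae_of_all _ fun p => ?_)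
          simp only [Prod.fst_swap, Prod.snd_swap]
          ring
      _ = ∫ p : X × X, χ p.2 * g p.2 * (χ p.1 * f p.1) ∂J := this
      _ = _ := by
          refine integral_congr_ae (ae_of_all _ fun p => ?_)
          ring
  have hres : Jχ.restrict S = J.restrict S := by
    rw [hJχ, restrict_withDensity hS]
    have : d =ᵐ[J.restrict S] 1 := by
      filter_upwards [ae_restrict_mem hS] with p hp
      simp [d, hχ1 hp.1, hχ1 hp.2]
    rw [withDensity_congr_ae this, withDensity_one]
  have hSS : (Prod.swap ⁻¹' S : Set (X × X)) = S := by
    ext p; simp [S]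
  calc (J.map Prod.swap).restrict S = (J.restrict S).map Prod.swap := by
        rw [Measure.restrict_map measurable_swap hS, hSS]
    _ = (Jχ.restrict S).map Prod.swap := by rw [hres]
    _ = (Jχ.map Prod.swap).restrict S := by
        rw [Measure.restrict_map measurable_swap hS, hSS]
    _ = J.restrict S := by rw [hswap, hres]

instance : IsFiniteMeasure lebAngle := by
  constructor
  rw [lebAngle, comap_subtype_coe_apply measurableSet_Ioo, Set.image_univ, Subtype.range_coe]
  exact measure_Ioo_lt_top

instance : IsFiniteMeasure nuMeasure := by
  unfold nuMeasure
  refine isFiniteMeasure_withDensity_ofReal (Integrable.hasFiniteIntegral ?_)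
  refine Integrable.mono' (integrable_const (1 : ℝ)) ?_ (ae_of_all _ fun a => ?_)
  · exact (by fun_prop : Continuous fun a : Angle => -Real.sin (a : ℝ)).aestronglyMeasurable
  · simpa using Real.abs_sin_le_one a

lemma lambda_eq : lambdaMeasure = (volume : Measure ℝ).prod nuMeasure := by
  unfold nuMeasure
  rw [prod_withDensity_right (by fun_prop)]
  rfl

lemma angularJoint_eq (Ptilde : Kernel D Angle) [IsMarkovKernel Ptilde] (x : ℝ) :
    angularJoint Ptilde x = (Kernel.const ℝ nuMeasure ⊗ₖ Ptilde) x := by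
  have hm : Measurable fun α : Angle => (Measure.dirac α).prod (Ptilde (x, α)) := by
    have : (fun α : Angle => (Measure.dirac α).prod (Ptilde (x, α)))
        = fun α => (Kernel.id ×ₖ (Ptilde.comap (fun α => (x, α)) (by fun_prop))) α := by
      ext1 α
      rw [Kernel.prod_apply, Kernel.id_apply, Kernel.comap_apply]
    rw [this]
    exact Kernel.measurable _
  ext s hs
  rw [angularJoint, Measure.bind_apply hs hm.aemeasurable, Kernel.compProd_apply hs]
  simp only [Kernel.const_apply]
  refine lintegral_congr fun α => ?_
  rw [Measure.dirac_prod, Measure.map_apply (by fun_prop) hs]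

/-- Equation (2.4): if the kernel `P((x,α); ·) = δ_x ⊗ P̃((x,α); ·)` is symmetric with
respect to `Λ`, then for Lebesgue-a.e. `x` the angular kernel `α ↦ P̃((x,α); ·)` is
symmetric with respect to `ν`, i.e. `∫ (δ_α ⊗ P̃((x,α);·)) dν(α)` is swap-invariant. -/
theorem angular_symm_of_kernel_symm
    (Ptilde : Kernel D Angle) [IsMarkovKernel Ptilde]
    (P : Kernel D D) [IsMarkovKernel P]
    (hP : ∀ z : D, P z = (Measure.dirac z.1).prod (Ptilde z))
    (hsym : ∀ f g : D → ℝ, Continuous f → HasCompactSupport f →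
      Continuous g → HasCompactSupport g →
      ∫ z, (∫ w, f w ∂(P z)) * g z ∂lambdaMeasure
        = ∫ z, (∫ w, g w ∂(P z)) * f z ∂lambdaMeasure) :
    ∀ᵐ x ∂(volume : Measure ℝ),
      (angularJoint Ptilde x).map Prod.swap = angularJoint Ptilde x := by
  have hΛ := lambda_eq
  have : LocallyCompactSpace Angle := isOpen_Ioo.locallyCompactSpace
  have : SFinite lambdaMeasure := hΛ ▸ inferInstance
  have : IsLocallyFiniteMeasure lambdaMeasure := hΛ ▸ inferInstance
  have hint : ∀ f : D → ℝ, Continuous f → HasCompactSupport f →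
      Integrable (fun p : D × D => f p.1) (lambdaMeasure ⊗ₘ P) := by
    intro f hf hfc
    have h1 : Integrable f (lambdaMeasure ⊗ₘ P).fst := by
      rw [Measure.fst_compProd]
      exact hf.integrable_of_hasCompactSupport hfc
    exact h1.comp_measurable measurable_fst
  have hJ : (lambdaMeasure ⊗ₘ P).map Prod.swap = lambdaMeasure ⊗ₘ P := by
    refine aux_swap _ hint ?_
    have e : ∀ f g : D → ℝ, Continuous f → HasCompactSupport f →
        Continuous g → HasCompactSupport g →
        ∫ p, f p.2 * g p.1 ∂(lambdaMeasure ⊗ₘ P)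
          = ∫ z, (∫ w, f w ∂(P z)) * g z ∂lambdaMeasure := by
      intro f g hf hfc hg hgc
      obtain ⟨C, hC⟩ := hfc.exists_bound_of_continuous hf
      rw [Measure.integral_compProd]
      · simp only [integral_mul_const]
      · exact (hint g hg hgc).bdd_mul
          (by fun_prop : Continuous fun p : D × D => f p.2).aestronglyMeasurable
          (ae_of_all _ fun p => hC p.2)
    intro f g hf hfc hg hgc
    rw [e f g hf hfc hg hgc, e g f hg hgc hf hfc]
    exact hsym f g hf hfc hg hgc
  have hJN : lambdaMeasure ⊗ₘ P = (lambdaMeasure ⊗ₘ Ptilde).map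
      (fun q : D × Angle => (q.1, (q.1.1, q.2))) := by
    ext s hs
    rw [Measure.map_apply (by fun_prop) hs, Measure.compProd_apply hs,
      Measure.compProd_apply (hs.preimage (by fun_prop))]
    refine lintegral_congr fun z => ?_
    rw [hP, Measure.dirac_prod, Measure.map_apply (by fun_prop) (hs.preimage (by fun_prop))]
    rfl
  have hN : (lambdaMeasure ⊗ₘ Ptilde).map (fun q : D × Angle => ((q.1.1, q.2), q.1.2))
      = lambdaMeasure ⊗ₘ Ptilde := by
    have h2 := congrArg (Measure.map (fun p : D × D => (p.1, p.2.2))) hJ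
    rw [hJN, Measure.map_map (by fun_prop) (by fun_prop), Measure.map_map (by fun_prop) (by fun_prop),
      Measure.map_map (by fun_prop) (by fun_prop)] at h2
    have h3 : ((fun p : D × D => (p.1, p.2.2)) ∘ fun q : D × Angle => (q.1, (q.1.1, q.2))) = id :=
      rfl
    rw [h3, Measure.map_id] at h2
    exact h2
  set κ : Kernel ℝ (Angle × Angle) := Kernel.const ℝ nuMeasure ⊗ₖ Ptilde with hκ
  have hvol : (volume : Measure ℝ) ⊗ₘ κ
      = (lambdaMeasure ⊗ₘ Ptilde).map MeasurableEquiv.prodAssoc := by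
    rw [hκ, ← Measure.compProd_assoc', Measure.compProd_const, hΛ]
  have hmain : (volume : Measure ℝ) ⊗ₘ (κ.map Prod.swap) = (volume : Measure ℝ) ⊗ₘ κ := by
    have h4 : (volume : Measure ℝ) ⊗ₘ (κ.map Prod.swap)
        = ((volume : Measure ℝ) ⊗ₘ κ).map (Prod.map id Prod.swap) := by
      rw [Measure.compProd_map measurable_swap]
    rw [h4, hvol, Measure.map_map (by fun_prop) (by fun_prop)]
    conv_rhs => rw [← hN, Measure.map_map (by fun_prop) (by fun_prop)]
    rfl
  have : IsFiniteKernel (κ.map Prod.swap) := Kernel.IsFiniteKernel.map _ _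
  filter_upwards [aux_ae_eq _ _ _ hmain] with x hx
  rw [angularJoint_eq, ← hκ, ← Kernel.map_apply _ measurable_swap, hx]

end
end

section
/- Let D = ℝ × (−π, 0), let Λ be the measure on D with density (x, α) ↦ −sin α with respect to two-dimensional Lebesgue measure, and let ν be the measure on (−π, 0) with density α ↦ −sin α. Let P̃ be a Markov kernel from ℝ × (−π, 0) to (−π, 0) such that for Lebesgue-almost every x ∈ ℝ the kernel α ↦ P̃((x, α); ·) is symmetric with respect to ν (i.e., ∫ (δ_α ⊗ P̃((x, α); ·)) dν(α) is swap-invariant on (−π, 0)²). Then there exists a sequence (K_m) of simple symmetric functions on D such that for every bounded continuous compactly supported h : D × D → ℝ, ∫_D h(z, K_m(z)) dΛ(z) → ∫_D ∫_{(−π,0)} h((x, α), (x, β)) P̃((x, α); dβ) dΛ(x, α) as m → ∞. -/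
open MeasureTheory ProbabilityTheory Filter

noncomputable section

/-- The open rectangle `(a k, b k) × (c k, d k)` viewed as a subset of `D`. -/
def rect (a b c d : ℕ → ℝ) (k : ℕ) : Set D :=
  {p : D | p.1 ∈ Set.Ioo (a k) (b k) ∧ (p.2 : ℝ) ∈ Set.Ioo (c k) (d k)}

/-- Definition 4.1 of the paper: `K : D → D` is a *simple symmetric function* if there is a
countable family of pairwise disjoint open rectangles `Q_k = (x₁ᵏ,x₂ᵏ) × (α₁ᵏ,α₂ᵏ) ⊂ D`
whose closures cover `D`, such that: base intervals are equal or disjoint; every bounded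
interval meets only finitely many distinct base intervals; on each `Q_k` the map `K` keeps
the first coordinate and sends the angle to a constant `c_k`; and the rectangles are
matched in pairs `(k, j)` over the same base interval, with equal `−sin α dα` masses of
their angle intervals, with `K(Q_k) ⊆ Q_j` and `K(Q_j) ⊆ Q_k`. -/
def IsSimpleSymmetric (K : D → D) : Prop :=
  ∃ a b c d : ℕ → ℝ,
    -- nondegenerate rectangles contained in `D`
    (∀ k, a k < b k ∧ -Real.pi ≤ c k ∧ c k < d k ∧ d k ≤ 0) ∧
    -- pairwise disjoint
    (∀ k j, k ≠ j → Disjoint (rect a b c d k) (rect a b c d j)) ∧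
    -- closures cover `D`
    (⋃ k, closure (rect a b c d k)) = Set.univ ∧
    -- base intervals are equal or disjoint
    (∀ k j, (a k = a j ∧ b k = b j) ∨
      Disjoint (Set.Ioo (a k) (b k)) (Set.Ioo (a j) (b j))) ∧
    -- every bounded interval meets only finitely many distinct base intervals
    (∀ M : ℝ, 0 < M →
      {p : ℝ × ℝ | ∃ k, p = (a k, b k) ∧
        (Set.Ioo (a k) (b k) ∩ Set.Ioo (-M) M).Nonempty}.Finite) ∧
    -- on each rectangle, `K` fixes the position and maps the angle to a constant
    (∀ k, ∃ ck : Angle, ∀ p ∈ rect a b c d k, K p = (p.1, ck)) ∧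
    -- matching pairs of rectangles interchanged by `K`
    (∀ k, ∃ j, a j = a k ∧ b j = b k ∧
      (∫ α in Set.Ioo (c k) (d k), -Real.sin α) =
        (∫ α in Set.Ioo (c j) (d j), -Real.sin α) ∧
      K '' rect a b c d k ⊆ rect a b c d j ∧
      K '' rect a b c d j ⊆ rect a b c d k)

namespace Refl

open Set

def angOf (c : ℝ) : Angle :=
  if h : c ∈ Ioo (-1:ℝ) 1 then ⟨-Real.arccos c, by
    constructor
    · have := Real.arccos_lt_pi.2 h.1; linarith
    · have := Real.arccos_pos.2 h.2; linarith⟩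
  else ⟨-Real.pi/2, by constructor <;> linarith [Real.pi_pos]⟩

lemma cos_angOf {c : ℝ} (h : c ∈ Ioo (-1:ℝ) 1) : Real.cos (angOf c : ℝ) = c := by
  unfold angOf
  rw [dif_pos h]
  simp only [Real.cos_neg]
  exact Real.cos_arccos h.1.le h.2.le

lemma cos_mem (α : Angle) : Real.cos (α:ℝ) ∈ Ioo (-1:ℝ) 1 := by
  have h1 : (-(α:ℝ)) ∈ Icc 0 Real.pi := ⟨by linarith [α.2.2], by linarith [α.2.1]⟩
  rw [← Real.cos_neg]
  constructor
  · rw [← Real.cos_pi]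
    exact Real.strictAntiOn_cos h1 ⟨Real.pi_pos.le, le_rfl⟩ (by linarith [α.2.1])
  · rw [← Real.cos_zero]
    exact Real.strictAntiOn_cos ⟨le_rfl, Real.pi_pos.le⟩ h1 (by linarith [α.2.2])

lemma angle_eq (α : Angle) : (α:ℝ) = -Real.arccos (Real.cos α) := by
  rw [← Real.cos_neg, Real.arccos_cos] <;> linarith [α.2.1, α.2.2]

/-- for u ∈ [-1,1]: -arccos u < α ↔ u < cos α -/
lemma lt_angle_iff (α : Angle) {u : ℝ} (hu : u ∈ Icc (-1:ℝ) 1) :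
    -Real.arccos u < (α:ℝ) ↔ u < Real.cos α := by
  rw [angle_eq α, neg_lt_neg_iff]
  have := cos_mem α
  rw [← angle_eq α]
  exact Real.strictAntiOn_arccos.lt_iff_gt ⟨this.1.le, this.2.le⟩ hu

lemma angle_lt_iff (α : Angle) {u : ℝ} (hu : u ∈ Icc (-1:ℝ) 1) :
    (α:ℝ) < -Real.arccos u ↔ Real.cos α < u := by
  rw [angle_eq α, neg_lt_neg_iff]
  have := cos_mem α
  rw [← angle_eq α]
  exact Real.strictAntiOn_arccos.lt_iff_gt hu ⟨this.1.le, this.2.le⟩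

def ac (n : ℕ) (α : Angle) : ℕ := ⌊(n:ℝ) * (Real.cos α + 1)⌋₊

lemma ac_eq_iff {n : ℕ} (hn : 0 < n) (α : Angle) (p : ℕ) :
    ac n α = p ↔ (-1 + (p:ℝ)/n ≤ Real.cos α ∧ Real.cos α < -1 + ((p:ℝ)+1)/n) := by
  have hn' : (0:ℝ) < n := by exact_mod_cast hn
  unfold ac
  rw [Nat.floor_eq_iff (by have := (cos_mem α).1; apply mul_nonneg hn'.le; linarith)]
  have e1 : (p:ℝ) ≤ n * (Real.cos α + 1) ↔ -1 + (p:ℝ)/n ≤ Real.cos α := by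
    rw [← div_le_iff₀' hn']; constructor <;> intro h <;> linarith
  have e2 : n * (Real.cos α + 1) < (p:ℝ)+1 ↔ Real.cos α < -1 + ((p:ℝ)+1)/n := by
    rw [← lt_div_iff₀' hn']; constructor <;> intro h <;> linarith
  rw [e1, e2]

lemma ac_lt {n : ℕ} (hn : 0 < n) (α : Angle) : ac n α < 2 * n := by
  have hn' : (0:ℝ) < n := by exact_mod_cast hn
  unfold ac
  rw [Nat.floor_lt (by have := (cos_mem α).1; apply mul_nonneg hn'.le; linarith)]
  push_cast
  nlinarith [(cos_mem α).2]

lemma measurable_ac (n : ℕ) : Measurable (ac n) := by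
  unfold ac
  fun_prop

structure Good (n : ℕ) (M : ℤ → ℕ → ℕ → ℝ) : Prop where
  npos : 0 < n
  nonneg : ∀ i p q, 0 ≤ M i p q
  symm : ∀ i p q, M i p q = M i q p
  sum : ∀ i p, p < 2 * n → ∑ q ∈ Finset.range (2*n), M i p q = 1 / n

def CC (n : ℕ) (M : ℤ → ℕ → ℕ → ℝ) (i : ℤ) (p q : ℕ) : ℝ :=
  -1 + (p:ℝ)/n + ∑ q' ∈ Finset.range q, M i p q'

lemma CC_zero (n M i p) : CC n M i p 0 = -1 + (p:ℝ)/n := by simp [CC]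

lemma CC_succ (n M i p q) : CC n M i p (q+1) = CC n M i p q + M i p q := by
  simp [CC, Finset.sum_range_succ]; ring

lemma CC_mono {n M} (g : Good n M) (i p) : Monotone (CC n M i p) := by
  apply monotone_nat_of_le_succ
  intro q
  rw [CC_succ]; linarith [g.nonneg i p q]

lemma CC_top {n M} (g : Good n M) (i) {p} (hp : p < 2 * n) :
    CC n M i p (2*n) = -1 + ((p:ℝ)+1)/n := by
  unfold CC; rw [g.sum i p hp]; ring

lemma CC_lb {n M} (g : Good n M) (i) (p q : ℕ) : -1 + (p:ℝ)/n ≤ CC n M i p q := by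
  rw [← CC_zero n M i p]; exact CC_mono g i p (Nat.zero_le _)

lemma CC_ub {n M} (g : Good n M) (i) {p q} (hp : p < 2 * n) (hq : q ≤ 2 * n) :
    CC n M i p q ≤ -1 + ((p:ℝ)+1)/n := by
  rw [← CC_top g i hp]; exact CC_mono g i p hq

lemma CC_mem {n M} (g : Good n M) (i) {p q} (hp : p < 2 * n) (hq : q ≤ 2 * n) :
    CC n M i p q ∈ Icc (-1:ℝ) 1 := by
  have hn' : (0:ℝ) < n := by exact_mod_cast g.npos
  constructor
  · have := CC_lb g i p q
    have : 0 ≤ (p:ℝ)/n := by positivity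
    linarith
  · have := CC_ub g i hp hq
    have h2 : ((p:ℝ)+1) ≤ 2 * n := by exact_mod_cast hp
    have : ((p:ℝ)+1)/n ≤ 2 := by rw [div_le_iff₀ hn']; exact h2
    linarith

open Classical in
def qq (n : ℕ) (M : ℤ → ℕ → ℕ → ℝ) (z : D) : ℕ :=
  Nat.findGreatest (fun q => CC n M ⌊(n:ℝ) * z.1⌋ (ac n z.2) q ≤ Real.cos z.2) (2*n)

def midC (n : ℕ) (M : ℤ → ℕ → ℕ → ℝ) (i : ℤ) (p q : ℕ) : ℝ :=
  (CC n M i p q + CC n M i p (q+1)) / 2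

def KK (n : ℕ) (M : ℤ → ℕ → ℕ → ℝ) (z : D) : D :=
  (z.1, angOf (midC n M ⌊(n:ℝ) * z.1⌋ (qq n M z) (ac n z.2)))

lemma qq_spec {n M} (g : Good n M) (z : D) :
    qq n M z < 2 * n ∧ CC n M ⌊(n:ℝ) * z.1⌋ (ac n z.2) (qq n M z) ≤ Real.cos z.2 ∧
      Real.cos z.2 < CC n M ⌊(n:ℝ) * z.1⌋ (ac n z.2) (qq n M z + 1) := by
  classical
  have h := (ac_eq_iff g.npos z.2 _).1 rfl
  have hle : qq n M z ≤ 2 * n := Nat.findGreatest_le _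
  have h1 : CC n M ⌊(n:ℝ) * z.1⌋ (ac n z.2) (qq n M z) ≤ Real.cos z.2 := by
    refine Nat.findGreatest_spec (P := fun q => CC n M ⌊(n:ℝ) * z.1⌋ (ac n z.2) q ≤ Real.cos z.2)
      (Nat.zero_le (2*n)) ?_
    rw [CC_zero]; exact h.1
  have hne : qq n M z ≠ 2 * n := by
    intro he
    rw [he, CC_top g _ (ac_lt g.npos _)] at h1
    linarith [h.2]
  have hlt : qq n M z < 2 * n := lt_of_le_of_ne hle hne
  refine ⟨hlt, h1, ?_⟩
  have := Nat.findGreatest_is_greatest (P := fun q => CC n M ⌊(n:ℝ) * z.1⌋ (ac n z.2) q ≤ Real.cos z.2)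
    (n := 2*n) (k := qq n M z + 1) (Nat.lt_succ_self _) hlt
  exact not_le.1 this

lemma qq_eq_iff {n M} (g : Good n M) (z : D) (q : ℕ) :
    qq n M z = q ↔ CC n M ⌊(n:ℝ) * z.1⌋ (ac n z.2) q ≤ Real.cos z.2 ∧
      Real.cos z.2 < CC n M ⌊(n:ℝ) * z.1⌋ (ac n z.2) (q + 1) := by
  constructor
  · rintro rfl; exact (qq_spec g z).2
  · rintro ⟨h1, h2⟩
    obtain ⟨-, h3, h4⟩ := qq_spec g z
    have m := CC_mono g ⌊(n:ℝ) * z.1⌋ (ac n z.2)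
    apply le_antisymm
    · by_contra! hh
      have := m (Nat.succ_le_of_lt hh)
      simp only [Nat.succ_eq_add_one] at this
      linarith
    · by_contra! hh
      have := m (Nat.succ_le_of_lt hh)
      simp only [Nat.succ_eq_add_one] at this
      linarith

lemma ac_of_CC {n M} (g : Good n M) (α : Angle) (i : ℤ) {p q : ℕ} (hp : p < 2 * n)
    (hq : q < 2 * n) (h1 : CC n M i p q ≤ Real.cos α) (h2 : Real.cos α < CC n M i p (q+1)) :
    ac n α = p := by
  rw [ac_eq_iff g.npos]
  exact ⟨(CC_lb g i p q).trans h1, h2.trans_le (CC_ub g i hp hq)⟩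

lemma mid_spec {n M} (g : Good n M) (i : ℤ) {p q : ℕ} (hp : p < 2 * n)
    (hq : q < 2 * n) (hpos : 0 < M i p q) :
    Real.cos (angOf (midC n M i p q)) = midC n M i p q ∧
    CC n M i p q < midC n M i p q ∧ midC n M i p q < CC n M i p (q+1) := by
  have h1 := CC_succ n M i p q
  have a1 := CC_mem g i hp hq.le
  have a2 := CC_mem g i hp (Nat.succ_le_of_lt hq)
  simp only [Nat.succ_eq_add_one] at a2
  have b1 : CC n M i p q < midC n M i p q := by unfold midC; linarith
  have b2 : midC n M i p q < CC n M i p (q+1) := by unfold midC; linarith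
  exact ⟨cos_angOf ⟨by linarith [a1.1], by linarith [a2.2]⟩, b1, b2⟩

lemma M_pos {n M} (g : Good n M) (z : D) :
    0 < M ⌊(n:ℝ) * z.1⌋ (ac n z.2) (qq n M z) := by
  obtain ⟨-, h3, h4⟩ := qq_spec g z
  rw [CC_succ] at h4
  linarith

lemma ac_KK {n M} (g : Good n M) (z : D) : ac n (KK n M z).2 = qq n M z := by
  have hq := (qq_spec g z).1
  have hp := ac_lt g.npos z.2
  have hm := M_pos g z
  rw [g.symm] at hm
  obtain ⟨h1, h2, h3⟩ := mid_spec g _ hq hp hm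
  apply ac_of_CC g _ ⌊(n:ℝ) * z.1⌋ hq hp
  · change _ ≤ Real.cos (angOf _); rw [h1]; exact h2.le
  · change Real.cos (angOf _) < _; rw [h1]; exact h3

lemma measurable_qq (n M) : Measurable (qq n M) := by
  classical
  unfold qq
  apply measurable_findGreatest
  intro k _
  have h1 : Measurable (fun z : D => (⌊(n:ℝ) * z.1⌋, ac n z.2)) := by
    have := measurable_ac n
    fun_prop
  have h2 : Measurable (fun c : ℤ × ℕ => CC n M c.1 c.2 k) := Measurable.of_discrete
  apply measurableSet_le (h2.comp h1)
  fun_prop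

attribute [irreducible] qq angOf midC ac

lemma measurable_KK (n : ℕ) (M : ℤ → ℕ → ℕ → ℝ) : Measurable (KK n M) := by
  have h0 : Measurable (fun z : D => ⌊(n:ℝ) * z.1⌋) := by fun_prop
  have h1 : Measurable (fun z : D => (⌊(n:ℝ) * z.1⌋, qq n M z, ac n z.2)) :=
    h0.prodMk ((measurable_qq n M).prodMk ((measurable_ac n).comp measurable_snd))
  have h3 : Measurable (fun z : D => angOf (midC n M ⌊(n:ℝ) * z.1⌋ (qq n M z) (ac n z.2))) := by
    have h2 : Measurable (fun c : ℤ × ℕ × ℕ => angOf (midC n M c.1 c.2.1 c.2.2)) :=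
      Measurable.of_discrete
    exact h2.comp h1
  exact Measurable.prodMk measurable_fst h3

lemma KK_set {n M} (g : Good n M) (i : ℤ) {p q : ℕ} (hp : p < 2 * n) (hq : q < 2 * n) :
    {z : D | ⌊(n:ℝ) * z.1⌋ = i ∧ ac n z.2 = p ∧ ac n (KK n M z).2 = q} =
    {x : ℝ | ⌊(n:ℝ) * x⌋ = i} ×ˢ
      {α : Angle | CC n M i p q ≤ Real.cos α ∧ Real.cos α < CC n M i p (q+1)} := by
  ext z
  simp only [mem_ofPred_eq, mem_prod]
  rw [ac_KK g]
  constructor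
  · rintro ⟨rfl, rfl, rfl⟩
    exact ⟨rfl, (qq_spec g z).2⟩
  · rintro ⟨rfl, h1, h2⟩
    have := ac_of_CC g z.2 _ hp hq h1 h2
    refine ⟨rfl, this, ?_⟩
    rw [qq_eq_iff g, this]; exact ⟨h1, h2⟩

def RR (n : ℕ) (M : ℤ → ℕ → ℕ → ℝ) (i : ℤ) (p q : ℕ) : Set D :=
  {z : D | z.1 ∈ Ioo ((i:ℝ)/n) (((i:ℝ)+1)/n) ∧
    (z.2:ℝ) ∈ Ioo (-Real.arccos (CC n M i p q)) (-Real.arccos (CC n M i p (q+1)))}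

lemma floor_iff {n : ℕ} (hn : 0 < n) (x : ℝ) (i : ℤ) :
    ⌊(n:ℝ) * x⌋ = i ↔ ((i:ℝ)/n ≤ x ∧ x < ((i:ℝ)+1)/n) := by
  have hn' : (0:ℝ) < n := by exact_mod_cast hn
  rw [Int.floor_eq_iff, div_le_iff₀' hn', lt_div_iff₀' hn']

lemma mem_RR {n M} (g : Good n M) {i : ℤ} {p q : ℕ} (hp : p < 2 * n) (hq : q < 2 * n) (z : D) :
    z ∈ RR n M i p q ↔ z.1 ∈ Ioo ((i:ℝ)/n) (((i:ℝ)+1)/n) ∧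
      CC n M i p q < Real.cos z.2 ∧ Real.cos z.2 < CC n M i p (q+1) := by
  unfold RR
  simp only [mem_ofPred_eq]
  refine and_congr_right fun _ => ?_
  rw [mem_Ioo, lt_angle_iff _ (CC_mem g i hp hq.le),
    angle_lt_iff _ (CC_mem g i hp hq)]

lemma RR_spec {n M} (g : Good n M) {i : ℤ} {p q : ℕ} (hp : p < 2 * n) (hq : q < 2 * n) {z : D}
    (hz : z ∈ RR n M i p q) : ⌊(n:ℝ) * z.1⌋ = i ∧ ac n z.2 = p ∧ qq n M z = q := by
  rw [mem_RR g hp hq] at hz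
  obtain ⟨h1, h2, h3⟩ := hz
  have e1 : ⌊(n:ℝ) * z.1⌋ = i := (floor_iff g.npos _ _).2 ⟨h1.1.le, h1.2⟩
  have e2 := ac_of_CC g z.2 i hp hq h2.le h3
  refine ⟨e1, e2, ?_⟩
  rw [qq_eq_iff g, e1, e2]; exact ⟨h2.le, h3⟩

lemma KK_RR {n M} (g : Good n M) {i : ℤ} {p q : ℕ} (hp : p < 2 * n) (hq : q < 2 * n) {z : D}
    (hz : z ∈ RR n M i p q) : KK n M z = (z.1, angOf (midC n M i q p)) := by
  obtain ⟨h1, h2, h3⟩ := RR_spec g hp hq hz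
  unfold KK
  rw [h1, h2, h3]

lemma KK_image {n M} (g : Good n M) {i : ℤ} {p q : ℕ} (hp : p < 2 * n) (hq : q < 2 * n)
    (hpos : 0 < M i p q) : KK n M '' RR n M i p q ⊆ RR n M i q p := by
  rintro _ ⟨z, hz, rfl⟩
  rw [KK_RR g hp hq hz]
  rw [g.symm] at hpos
  obtain ⟨h1, h2, h3⟩ := mid_spec g i hq hp hpos
  rw [mem_RR g hq hp]
  refine ⟨((mem_RR g hp hq z).1 hz).1, ?_⟩
  simp only [h1]
  exact ⟨h2, h3⟩

lemma integral_sin {c d : ℝ} (h : c ≤ d) :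
    (∫ α in Ioo c d, -Real.sin α) = Real.cos d - Real.cos c := by
  rw [← integral_Ioc_eq_integral_Ioo, ← intervalIntegral.integral_of_le h]
  simp

lemma arccos_CC_lt {n M} (g : Good n M) {i : ℤ} {p q : ℕ} (hp : p < 2 * n) (hq : q < 2 * n)
    (hpos : 0 < M i p q) :
    -Real.arccos (CC n M i p q) < -Real.arccos (CC n M i p (q+1)) := by
  rw [neg_lt_neg_iff]
  apply Real.strictAntiOn_arccos (CC_mem g i hp hq.le) (CC_mem g i hp hq)
  rw [CC_succ]; linarith

lemma integral_RR {n M} (g : Good n M) {i : ℤ} {p q : ℕ} (hp : p < 2 * n) (hq : q < 2 * n)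
    (hpos : 0 < M i p q) :
    (∫ α in Ioo (-Real.arccos (CC n M i p q)) (-Real.arccos (CC n M i p (q+1))), -Real.sin α)
      = M i p q := by
  rw [integral_sin (arccos_CC_lt g hp hq hpos).le, Real.cos_neg, Real.cos_neg]
  have h1 := CC_mem g i hp hq.le
  have h2 := CC_mem g i hp hq
  rw [Real.cos_arccos h1.1 h1.2, Real.cos_arccos h2.1 h2.2, CC_succ]
  ring

lemma closure_rect' {a b c d : ℝ} (hab : a < b) (hcd : c < d) :
    closure {z : D | z.1 ∈ Ioo a b ∧ (z.2:ℝ) ∈ Ioo c d} =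
      {z : D | z.1 ∈ Icc a b ∧ (z.2:ℝ) ∈ Icc c d} := by
  have h1 : {z : D | z.1 ∈ Ioo a b ∧ (z.2:ℝ) ∈ Ioo c d} =
    Ioo a b ×ˢ ((Subtype.val : Angle → ℝ) ⁻¹' Ioo c d) := by ext; simp
  have h2 : IsOpenMap (Subtype.val : Angle → ℝ) := isOpen_Ioo.isOpenMap_subtype_val
  rw [h1, closure_prod_eq, ← h2.preimage_closure_eq_closure_preimage continuous_subtype_val,
    closure_Ioo hab.ne, closure_Ioo hcd.ne]
  ext; simp

lemma simple {n M} (g : Good n M) : IsSimpleSymmetric (KK n M) := by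
  have hn' : (0:ℝ) < n := by exact_mod_cast g.npos
  let ι := {t : ℤ × ℕ × ℕ // t.2.1 < 2 * n ∧ t.2.2 < 2 * n ∧ 0 < M t.1 t.2.1 t.2.2}
  have key : ∀ z : D, ∃ t : ι, t.1 = (⌊(n:ℝ) * z.1⌋, ac n z.2, qq n M z) := fun z =>
    ⟨⟨(⌊(n:ℝ) * z.1⌋, ac n z.2, qq n M z), ac_lt g.npos _, (qq_spec g z).1, M_pos g z⟩, rfl⟩
  have hinf : Infinite ι := by
    choose f hf using fun i : ℤ => key ((i:ℝ)/n, angOf 0)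
    apply Infinite.of_injective f
    intro i j hij
    have := congrArg (fun t : ι => t.1.1) hij
    simp only [hf] at this
    rw [mul_div_cancel₀ _ hn'.ne', mul_div_cancel₀ _ hn'.ne'] at this
    simpa using this
  have hc : Countable ι := inferInstance
  obtain ⟨hden⟩ := nonempty_denumerable ι
  let e : ℕ ≃ ι := (Denumerable.eqv ι).symm
  refine ⟨fun k => ((e k).1.1:ℝ)/n, fun k => (((e k).1.1:ℝ)+1)/n,
    fun k => -Real.arccos (CC n M (e k).1.1 (e k).1.2.1 (e k).1.2.2),
    fun k => -Real.arccos (CC n M (e k).1.1 (e k).1.2.1 ((e k).1.2.2+1)), ?_, ?_, ?_, ?_, ?_, ?_, ?_⟩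
  · intro k
    obtain ⟨hp, hq, hpos⟩ := (e k).2
    refine ⟨?_, ?_, arccos_CC_lt g hp hq hpos, ?_⟩
    · apply div_lt_div_of_pos_right _ hn'; linarith
    · simpa using Real.arccos_le_pi _
    · simpa using Real.arccos_nonneg _
  · intro k j hkj
    rw [Set.disjoint_left]
    intro z hz1 hz2
    apply hkj
    apply e.injective
    apply Subtype.ext
    obtain ⟨h1, h2, h3⟩ := RR_spec g (e k).2.1 (e k).2.2.1 (z := z) hz1
    obtain ⟨h1', h2', h3'⟩ := RR_spec g (e j).2.1 (e j).2.2.1 (z := z) hz2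
    exact Prod.ext (h1.symm.trans h1') (Prod.ext (h2.symm.trans h2') (h3.symm.trans h3'))
  · rw [eq_univ_iff_forall]
    intro z
    obtain ⟨t, ht⟩ := key z
    rw [mem_iUnion]
    refine ⟨e.symm t, ?_⟩
    unfold rect
    obtain ⟨hp, hq, hpos⟩ := t.2
    have hq2 := qq_spec g z
    have hf := (floor_iff g.npos z.1 _).1 rfl
    rw [closure_rect']
    · simp only [Equiv.apply_symm_apply, mem_ofPred_eq, mem_Icc]
      refine ⟨⟨?_, ?_⟩, ?_, ?_⟩
      · rw [ht]; exact hf.1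
      · rw [ht]; exact hf.2.le
      · rw [ht, angle_eq z.2]
        exact neg_le_neg (Real.antitone_arccos hq2.2.1)
      · rw [ht, angle_eq z.2]
        exact neg_le_neg (Real.antitone_arccos hq2.2.2.le)
    · apply div_lt_div_of_pos_right _ hn'; linarith
    · simp only [Equiv.apply_symm_apply]
      exact arccos_CC_lt g hp hq hpos
  · intro k j
    by_cases h : (e k).1.1 = (e j).1.1
    · left; simp only [h]; simp
    · right
      rw [Set.disjoint_left]
      intro x h1 h2
      apply h
      rw [← (floor_iff g.npos x _).2 ⟨h1.1.le, h1.2⟩, ← (floor_iff g.npos x _).2 ⟨h2.1.le, h2.2⟩]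
  · intro L hL
    apply ((Set.finite_Icc (⌊-(n:ℝ) * L - 1⌋) (⌈(n:ℝ) * L⌉)).image
      (fun i : ℤ => ((i:ℝ)/n, ((i:ℝ)+1)/n))).subset
    rintro _ ⟨k, rfl, x, ⟨hx1, hx2⟩, hx3, hx4⟩
    refine ⟨(e k).1.1, ⟨?_, ?_⟩, rfl⟩
    · have : -L < (((e k).1.1:ℝ)+1)/n := hx3.trans hx2
      rw [lt_div_iff₀ hn'] at this
      have h2 := Int.floor_le (-(n:ℝ) * L - 1)
      have : ((⌊-(n:ℝ) * L - 1⌋ : ℤ):ℝ) < (((e k).1.1 : ℤ):ℝ) := by linarith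
      exact_mod_cast this.le
    · have : ((e k).1.1:ℝ)/n < L := hx1.trans hx4
      rw [div_lt_iff₀ hn'] at this
      have h2 := Int.le_ceil ((n:ℝ) * L)
      have : (((e k).1.1 : ℤ):ℝ) < ((⌈(n:ℝ) * L⌉ : ℤ):ℝ) := by linarith
      exact_mod_cast this.le
  · intro k
    exact ⟨_, fun z hz => KK_RR g (e k).2.1 (e k).2.2.1 hz⟩
  · intro k
    obtain ⟨hp, hq, hpos⟩ := (e k).2
    have hpos' := hpos
    rw [g.symm] at hpos'
    have hj : ∃ j, (e j).1 = ((e k).1.1, (e k).1.2.2, (e k).1.2.1) :=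
      ⟨e.symm ⟨((e k).1.1, (e k).1.2.2, (e k).1.2.1), hq, hp, hpos'⟩, by simp⟩
    obtain ⟨j, hj⟩ := hj
    refine ⟨j, ?_, ?_, ?_, ?_, ?_⟩
    · simp only [hj]
    · simp only [hj]
    · simp only [hj]
      rw [integral_RR g hp hq hpos, integral_RR g hq hp hpos', g.symm]
    · change KK n M '' RR n M _ _ _ ⊆ RR n M _ _ _
      rw [hj]
      exact KK_image g hp hq hpos
    · change KK n M '' RR n M _ _ _ ⊆ RR n M _ _ _
      rw [hj]
      exact KK_image g hq hp hpos'

instance : IsFiniteMeasure lebAngle := by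
  constructor
  unfold lebAngle
  rw [(MeasurableEmbedding.subtype_coe measurableSet_Ioo).comap_apply, image_univ,
    Subtype.range_coe]
  exact measure_Ioo_lt_top

instance : SFinite nuMeasure := by unfold nuMeasure; infer_instance

lemma lambda_eq : lambdaMeasure = (volume : Measure ℝ).prod nuMeasure := by
  unfold lambdaMeasure nuMeasure
  rw [prod_withDensity_right]
  have : Measurable (fun α : ℝ => ENNReal.ofReal (-Real.sin α)) := by fun_prop
  exact (this.comp measurable_subtype_coe)

instance : SFinite lambdaMeasure := by rw [lambda_eq]; infer_instance

lemma nu_Ico {u v : ℝ} (hu : u ∈ Icc (-1:ℝ) 1) (hv : v ∈ Icc (-1:ℝ) 1) (huv : u ≤ v) :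
    nuMeasure {α : Angle | u ≤ Real.cos α ∧ Real.cos α < v} = ENNReal.ofReal (v - u) := by
  have hS : {α : Angle | u ≤ Real.cos α ∧ Real.cos α < v} =
      (Subtype.val : Angle → ℝ) ⁻¹' (Ico (-Real.arccos u) (-Real.arccos v)) := by
    ext α
    simp only [mem_ofPred_eq, mem_preimage, mem_Ico]
    rw [angle_lt_iff α hv, ← not_lt, ← not_lt, angle_lt_iff α hu]
  have hle : -Real.arccos u ≤ -Real.arccos v := neg_le_neg (Real.antitone_arccos huv)
  have hsub : Ico (-Real.arccos u) (-Real.arccos v) ⊆ Ico (-Real.pi) 0 := by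
    apply Ico_subset_Ico
    · simpa using Real.arccos_le_pi _
    · simpa using Real.arccos_nonneg _
  have hm : MeasurableSet ((Subtype.val : Angle → ℝ) ⁻¹' (Ico (-Real.arccos u) (-Real.arccos v))) :=
    measurable_subtype_coe measurableSet_Ico
  rw [hS]
  unfold nuMeasure
  rw [withDensity_apply _ hm, ← lintegral_indicator hm]
  have e1 : ∀ α : Angle, ((Subtype.val : Angle → ℝ) ⁻¹'
      (Ico (-Real.arccos u) (-Real.arccos v))).indicator
        (fun α : Angle => ENNReal.ofReal (-Real.sin (α:ℝ))) α =
      (fun x : ℝ => (Ico (-Real.arccos u) (-Real.arccos v)).indicator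
        (fun x : ℝ => ENNReal.ofReal (-Real.sin x)) x) α := fun α => rfl
  simp_rw [e1]
  unfold lebAngle
  rw [lintegral_subtype_comap measurableSet_Ioo (fun x : ℝ =>
    (Ico (-Real.arccos u) (-Real.arccos v)).indicator
        (fun x : ℝ => ENNReal.ofReal (-Real.sin x)) x),
    Measure.restrict_congr_set Ioo_ae_eq_Ico, lintegral_indicator measurableSet_Ico,
    Measure.restrict_restrict measurableSet_Ico, inter_eq_self_of_subset_left hsub,
    Measure.restrict_congr_set Ioo_ae_eq_Ico.symm, ← ofReal_integral_eq_lintegral_ofReal,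
    integral_sin hle, Real.cos_neg, Real.cos_neg, Real.cos_arccos hu.1 hu.2,
    Real.cos_arccos hv.1 hv.2]
  · have : Continuous (fun x : ℝ => -Real.sin x) := by fun_prop
    exact (this.integrableOn_Icc (a := -Real.arccos u) (b := -Real.arccos v)).mono_set Ioo_subset_Icc_self
  · apply (ae_restrict_iff' measurableSet_Ioo).2
    filter_upwards with x hx
    have := hsub (Ioo_subset_Ico_self hx)
    have := Real.sin_nonpos_of_nonpos_of_neg_pi_le this.2.le this.1
    simpa using this

lemma vol_floor {n : ℕ} (hn : 0 < n) (i : ℤ) :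
    volume {x : ℝ | ⌊(n:ℝ) * x⌋ = i} = ENNReal.ofReal (1 / n) := by
  have : {x : ℝ | ⌊(n:ℝ) * x⌋ = i} = Ico ((i:ℝ)/n) (((i:ℝ)+1)/n) := by
    ext x; simp only [mem_ofPred_eq, mem_Ico]; exact floor_iff hn x i
  rw [this, Real.volume_Ico]
  congr 1; ring

lemma nu_ac {n : ℕ} (hn : 0 < n) {p : ℕ} (hp : p < 2 * n) :
    nuMeasure {α | ac n α = p} = ENNReal.ofReal (1 / n) := by
  have hn' : (0:ℝ) < n := by exact_mod_cast hn
  simp_rw [ac_eq_iff hn]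
  have h1 : (p:ℝ) + 1 ≤ 2 * n := by exact_mod_cast hp
  have h2 : ((p:ℝ)+1)/n ≤ 2 := by rwa [div_le_iff₀ hn']
  have h3 : (0:ℝ) ≤ (p:ℝ)/n := by positivity
  have h4 : ((p:ℝ)+1)/n = p/n + 1/n := by ring
  have h5 : (0:ℝ) < 1/n := by positivity
  rw [nu_Ico ⟨by linarith, by linarith⟩ ⟨by linarith, by linarith⟩ (by linarith)]
  congr 1; linarith

def phi (n : ℕ) (w : D × Angle) : ℤ × ℕ × ℕ := (⌊(n:ℝ) * w.1.1⌋, ac n w.1.2, ac n w.2)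

lemma measurable_phi (n : ℕ) : Measurable (phi n) := by
  have h0 : Measurable (fun z : D × Angle => ⌊(n:ℝ) * z.1.1⌋) := by fun_prop
  exact h0.prodMk (((measurable_ac n).comp (measurable_snd.comp measurable_fst)).prodMk
    ((measurable_ac n).comp measurable_snd))

variable (P : Kernel D Angle) [IsMarkovKernel P]

def mm (n : ℕ) (i : ℤ) (p q : ℕ) : ENNReal := (lambdaMeasure ⊗ₘ P) (phi n ⁻¹' {(i, p, q)})

def MM (n : ℕ) (i : ℤ) (p q : ℕ) : ℝ := n * (mm P n i p q).toReal

lemma angularJoint_eq (x : ℝ) :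
    angularJoint P x = nuMeasure ⊗ₘ (P.comap (Prod.mk x) measurable_prodMk_left) := by
  unfold angularJoint
  rw [Measure.compProd_eq_comp_prod]
  congr 1
  ext α : 1
  rw [Kernel.prod_apply, Kernel.id_apply, Kernel.comap_apply]

lemma measurableSet_ac (n p : ℕ) : MeasurableSet {α | ac n α = p} :=
  measurable_ac n (measurableSet_singleton p)

lemma measurableSet_fl (n : ℕ) (i : ℤ) : MeasurableSet {x : ℝ | ⌊(n:ℝ) * x⌋ = i} := by
  have h0 : Measurable (fun x : ℝ => ⌊(n:ℝ) * x⌋) := by fun_prop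
  exact h0 (measurableSet_singleton i)

lemma mm_eq (n : ℕ) (i : ℤ) (p q : ℕ) :
    mm P n i p q = ∫⁻ x in {x : ℝ | ⌊(n:ℝ) * x⌋ = i},
      angularJoint P x ({α | ac n α = p} ×ˢ {α | ac n α = q}) := by
  have hset : phi n ⁻¹' {(i, p, q)} =
      ({x : ℝ | ⌊(n:ℝ) * x⌋ = i} ×ˢ {α | ac n α = p}) ×ˢ {α | ac n α = q} := by
    ext w; simp [phi, and_assoc]
  unfold mm
  rw [hset, Measure.compProd_apply_prod ((measurableSet_fl n i).prod (measurableSet_ac n p))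
    (measurableSet_ac n q), lambda_eq, ← Measure.prod_restrict, lintegral_prod]
  · apply lintegral_congr
    intro x
    rw [angularJoint_eq, Measure.compProd_apply_prod (measurableSet_ac n p) (measurableSet_ac n q)]
    simp
  · exact (Kernel.measurable_coe P (measurableSet_ac n q)).aemeasurable

lemma mm_symm (hsym : ∀ᵐ x ∂(volume : Measure ℝ),
      (angularJoint P x).map Prod.swap = angularJoint P x) (n : ℕ) (i : ℤ) (p q : ℕ) :
    mm P n i p q = mm P n i q p := by
  rw [mm_eq, mm_eq]
  apply lintegral_congr_ae
  filter_upwards [ae_restrict_of_ae hsym] with x hx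
  rw [← hx, Measure.map_apply measurable_swap
    ((measurableSet_ac n p).prod (measurableSet_ac n q)), hx]
  congr 1
  ext w; simp

lemma mm_sum {n : ℕ} (hn : 0 < n) (i : ℤ) {p : ℕ} (hp : p < 2 * n) :
    ∑ q ∈ Finset.range (2*n), mm P n i p q = ENNReal.ofReal (1/n) * ENNReal.ofReal (1/n) := by
  unfold mm
  rw [← measure_biUnion_finset]
  · have hset : (⋃ q ∈ Finset.range (2*n), phi n ⁻¹' {(i, p, q)}) =
      ({x : ℝ | ⌊(n:ℝ) * x⌋ = i} ×ˢ {α | ac n α = p}) ×ˢ univ := by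
      ext w
      have := ac_lt hn w.2
      simp only [phi, mem_iUnion, mem_preimage, mem_singleton_iff, Prod.mk.injEq, mem_prod,
        mem_ofPred_eq, mem_univ, and_true, Finset.mem_range]
      constructor
      · rintro ⟨q, hq, h1, h2, h3⟩; exact ⟨h1, h2⟩
      · rintro ⟨h1, h2⟩; exact ⟨_, this, h1, h2, rfl⟩
    rw [hset, Measure.compProd_apply_prod ((measurableSet_fl n i).prod (measurableSet_ac n p))
      MeasurableSet.univ]
    simp only [measure_univ, lintegral_one, Measure.restrict_apply_univ]
    rw [lambda_eq, Measure.prod_prod, vol_floor hn, nu_ac hn hp]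
  · intro q _ q' _ hne
    apply Disjoint.preimage
    simp [hne]
  · intro q _
    exact measurable_phi n (measurableSet_singleton _)

lemma mm_ge {n : ℕ} (hn : 0 < n) (i : ℤ) {p q : ℕ} (h : ¬ (p < 2 * n ∧ q < 2 * n)) :
    phi n ⁻¹' {(i, p, q)} = ∅ := by
  ext w
  simp only [phi, mem_preimage, mem_singleton_iff, Prod.mk.injEq, mem_empty_iff_false, iff_false]
  rintro ⟨-, rfl, rfl⟩
  exact h ⟨ac_lt hn _, ac_lt hn _⟩

lemma mm_ne_top {n : ℕ} (hn : 0 < n) (i : ℤ) (p q : ℕ) : mm P n i p q ≠ ⊤ := by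
  by_cases h : p < 2 * n ∧ q < 2 * n
  · have h1 := mm_sum P hn i h.1
    have h2 : mm P n i p q ≤ ∑ q ∈ Finset.range (2*n), mm P n i p q :=
      Finset.single_le_sum (f := fun q => mm P n i p q) (fun _ _ => zero_le) (Finset.mem_range.2 h.2)
    rw [h1] at h2
    exact ne_top_of_le_ne_top (ENNReal.mul_ne_top ENNReal.ofReal_ne_top ENNReal.ofReal_ne_top) h2
  · unfold mm
    rw [mm_ge hn i h]; simp

lemma good (hsym : ∀ᵐ x ∂(volume : Measure ℝ),
      (angularJoint P x).map Prod.swap = angularJoint P x) {n : ℕ} (hn : 0 < n) :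
    Good n (MM P n) where
  npos := hn
  nonneg i p q := by unfold MM; positivity
  symm i p q := by unfold MM; rw [mm_symm P hsym]
  sum i p hp := by
    unfold MM
    have hn' : (0:ℝ) < n := by exact_mod_cast hn
    rw [← Finset.mul_sum, ← ENNReal.toReal_sum (fun q _ => mm_ne_top P hn i p q), mm_sum P hn i hp,
      ENNReal.toReal_mul, ENNReal.toReal_ofReal (by positivity)]
    field_simp

def muK (n : ℕ) : Measure (D × Angle) :=
  lambdaMeasure.map (fun z => (z, (KK n (MM P n) z).2))

lemma measurable_gr (n : ℕ) : Measurable (fun z => (z, (KK n (MM P n) z).2)) :=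
  measurable_id.prodMk (measurable_snd.comp (measurable_KK n _))

lemma map_phi (hsym : ∀ᵐ x ∂(volume : Measure ℝ),
      (angularJoint P x).map Prod.swap = angularJoint P x) {n : ℕ} (hn : 0 < n) :
    (muK P n).map (phi n) = (lambdaMeasure ⊗ₘ P).map (phi n) := by
  have g := good P hsym hn
  have hn' : (0:ℝ) < n := by exact_mod_cast hn
  apply Measure.ext_of_singleton
  rintro ⟨i, p, q⟩
  rw [Measure.map_apply (measurable_phi n) (measurableSet_singleton _),
    Measure.map_apply (measurable_phi n) (measurableSet_singleton _)]
  by_cases h : p < 2 * n ∧ q < 2 * n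
  · unfold muK
    rw [Measure.map_apply (measurable_gr P n) (measurable_phi n (measurableSet_singleton _))]
    have hset : (fun z => (z, (KK n (MM P n) z).2)) ⁻¹' (phi n ⁻¹' {(i, p, q)}) =
      {z : D | ⌊(n:ℝ) * z.1⌋ = i ∧ ac n z.2 = p ∧ ac n (KK n (MM P n) z).2 = q} := by
      ext z; simp [phi]
    rw [hset, KK_set g i h.1 h.2, lambda_eq, Measure.prod_prod, vol_floor hn,
      nu_Ico (CC_mem g i h.1 h.2.le) (CC_mem g i h.1 h.2) (CC_mono g i p (Nat.le_succ q)), CC_succ,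
      ← ENNReal.ofReal_mul (by positivity), ← lambda_eq]
    change _ = mm P n i p q
    rw [← ENNReal.ofReal_toReal (mm_ne_top P hn i p q)]
    congr 1
    unfold MM
    field_simp
    ring
  · rw [mm_ge hn i h]; simp

lemma nu_univ : nuMeasure univ = 2 := by
  have : (univ : Set Angle) = {α : Angle | (-1:ℝ) ≤ Real.cos α ∧ Real.cos α < 1} := by
    ext α; have := cos_mem α; simp [this.2, this.1.le]
  rw [this, nu_Ico (by simp) (by simp) (by norm_num)]
  norm_num

lemma cell_close {δ : ℝ} (hδ : 0 < δ) : ∃ n0 : ℕ, ∀ n : ℕ, n0 ≤ n → 0 < n → ∀ z z' : D,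
    ⌊(n:ℝ) * z.1⌋ = ⌊(n:ℝ) * z'.1⌋ → ac n z.2 = ac n z'.2 → dist z z' < δ := by
  have huc : UniformContinuousOn Real.arccos (Icc (-1) 1) :=
    isCompact_Icc.uniformContinuousOn_of_continuous Real.continuous_arccos.continuousOn
  rw [Metric.uniformContinuousOn_iff] at huc
  obtain ⟨η, hη, H⟩ := huc δ hδ
  obtain ⟨n0, hn0⟩ := exists_nat_one_div_lt (lt_min hδ hη)
  refine ⟨n0 + 1, fun n hn hpos z z' h1 h2 => ?_⟩
  have hn' : (0:ℝ) < n := by exact_mod_cast hpos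
  have hlt : (1:ℝ) / n < min δ η := by
    refine lt_of_le_of_lt ?_ hn0
    apply one_div_le_one_div_of_le (by positivity)
    exact_mod_cast hn
  have a1 := (floor_iff hpos z.1 _).1 rfl
  have a2 := (floor_iff hpos z'.1 _).1 h1.symm
  have b1 := (ac_eq_iff hpos z.2 _).1 rfl
  have b2 := (ac_eq_iff hpos z'.2 _).1 h2.symm
  rw [add_div] at a1 a2 b1 b2
  rw [Prod.dist_eq, max_lt_iff]
  constructor
  · rw [Real.dist_eq, abs_lt]
    have := hlt.trans_le (min_le_left _ _)
    constructor <;> linarith [a1.1, a1.2, a2.1, a2.2]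
  · rw [Subtype.dist_eq, angle_eq z.2, angle_eq z'.2, dist_neg_neg]
    have c1 := cos_mem z.2
    have c2 := cos_mem z'.2
    apply H _ ⟨c1.1.le, c1.2.le⟩ _ ⟨c2.1.le, c2.2.le⟩
    rw [Real.dist_eq, abs_lt]
    have := hlt.trans_le (min_le_right _ _)
    constructor <;> linarith [b1.1, b1.2, b2.1, b2.2]

def SS (R : ℕ) : Set (D × Angle) := {w | -(R:ℝ) ≤ w.1.1 ∧ w.1.1 < R}

def TT (n R : ℕ) : Set (ℤ × ℕ × ℕ) := {c | -((n:ℤ) * R) ≤ c.1 ∧ c.1 < (n:ℤ) * R}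

lemma SS_eq {n : ℕ} (hn : 0 < n) (R : ℕ) : SS R = phi n ⁻¹' TT n R := by
  have hn' : (0:ℝ) < n := by exact_mod_cast hn
  ext w
  simp only [SS, TT, phi, mem_preimage, mem_ofPred_eq]
  rw [Int.le_floor, Int.floor_lt]
  push_cast
  rw [← mul_neg, mul_le_mul_iff_right₀ hn', mul_lt_mul_iff_right₀ hn']

lemma SS_meas (R : ℕ) : (lambdaMeasure ⊗ₘ P) (SS R) < ⊤ := by
  have : SS R = (Ico (-(R:ℝ)) R ×ˢ univ) ×ˢ univ := by ext w; simp [SS]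
  rw [this, Measure.compProd_apply_prod (measurableSet_Ico.prod MeasurableSet.univ)
      MeasurableSet.univ]
  simp only [measure_univ, lintegral_one, Measure.restrict_apply_univ]
  rw [lambda_eq, Measure.prod_prod, nu_univ, Real.volume_Ico]
  exact ENNReal.mul_lt_top ENNReal.ofReal_lt_top (by simp)

lemma SS_muK (hsym : ∀ᵐ x ∂(volume : Measure ℝ),
      (angularJoint P x).map Prod.swap = angularJoint P x) {n : ℕ} (hn : 0 < n) (R : ℕ) :
    muK P n (SS R) = (lambdaMeasure ⊗ₘ P) (SS R) := by
  have h := congrArg (fun m => m (TT n R)) (map_phi P hsym hn)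
  change (muK P n).map (phi n) (TT n R) = (lambdaMeasure ⊗ₘ P).map (phi n) (TT n R) at h
  rw [Measure.map_apply (measurable_phi n) (MeasurableSet.of_discrete),
    Measure.map_apply (measurable_phi n) (MeasurableSet.of_discrete), ← SS_eq hn] at h
  exact h

lemma half_bound (μ : Measure (D × Angle)) {n R : ℕ} (hn : 0 < n) (f : D × Angle → ℝ)
    (hμ : μ (SS R) < ⊤) (hfm : Measurable f) {C ε : ℝ} (hC : ∀ w, |f w| ≤ C)
    (hS : ∀ w, w ∉ SS R → f w = 0) (G : ℤ × ℕ × ℕ → ℝ) (hG : ∀ w, |f w - G (phi n w)| ≤ ε)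
    (hGC : ∀ c, |G c| ≤ C) :
    |∫ w, f w ∂μ - ∫ c in TT n R, G c ∂(μ.map (phi n))| ≤ ε * μ.real (SS R) := by
  have hGm : Measurable G := Measurable.of_discrete
  rw [setIntegral_map (MeasurableSet.of_discrete) hGm.aestronglyMeasurable
    (measurable_phi n).aemeasurable, ← SS_eq hn,
    ← setIntegral_eq_integral_of_forall_compl_eq_zero hS, ← integral_sub]
  · exact norm_setIntegral_le_of_norm_le_const (f := fun w => f w - G (phi n w)) hμ
      (fun w _ => hG w)
  · exact Measure.integrableOn_of_bounded hμ.ne hfm.aestronglyMeasurable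
      (Eventually.of_forall hC)
  · exact Measure.integrableOn_of_bounded hμ.ne (hGm.comp (measurable_phi n)).aestronglyMeasurable
      (Eventually.of_forall fun w => hGC (phi n w))

lemma main_conv (hsym : ∀ᵐ x ∂(volume : Measure ℝ),
      (angularJoint P x).map Prod.swap = angularJoint P x)
    (h : D × D → ℝ) (hcont : Continuous h) (hsupp : HasCompactSupport h) :
    Tendsto (fun m : ℕ => ∫ z, h (z, KK (m+1) (MM P (m+1)) z) ∂lambdaMeasure) atTop
          (nhds (∫ z, ∫ β, h (z, (z.1, β)) ∂(P z) ∂lambdaMeasure)) := by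
  let f : D × Angle → ℝ := fun w => h (w.1, (w.1.1, w.2))
  have hfc : Continuous f := by fun_prop
  have hfm : Measurable f := hfc.measurable
  obtain ⟨C, hC⟩ := hcont.bounded_above_of_compact_support hsupp
  have hCf : ∀ w, |f w| ≤ C := fun w => hC _
  obtain ⟨R, hR⟩ : ∃ R : ℕ, ∀ w, w ∉ SS R → f w = 0 := by
    have hk : IsCompact ((fun y : D × D => y.1.1) '' tsupport h) :=
      IsCompact.image hsupp (by fun_prop)
    obtain ⟨r, hr⟩ := hk.isBounded.subset_closedBall 0
    obtain ⟨R, hR⟩ := exists_nat_gt r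
    refine ⟨R, fun w hw => ?_⟩
    by_contra hne
    apply hw
    have hm : (w.1, (w.1.1, w.2)) ∈ tsupport h := subset_tsupport _ hne
    have := hr ⟨_, hm, rfl⟩
    rw [mem_closedBall_zero_iff, Real.norm_eq_abs, abs_le] at this
    exact ⟨by linarith [this.1], by linarith [this.2]⟩
  have huc := hsupp.uniformContinuous_of_continuous hcont
  rw [Metric.uniformContinuous_iff] at huc
  have hint : Integrable f (lambdaMeasure ⊗ₘ P) := by
    have h1 : IntegrableOn f (SS R) (lambdaMeasure ⊗ₘ P) :=
      Measure.integrableOn_of_bounded (SS_meas P R).ne hfm.aestronglyMeasurable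
        (Eventually.of_forall hCf)
    exact h1.integrable_of_forall_notMem_eq_zero hR
  have hlim : (∫ z, ∫ β, h (z, (z.1, β)) ∂(P z) ∂lambdaMeasure) =
      ∫ w, f w ∂(lambdaMeasure ⊗ₘ P) := (Measure.integral_compProd hint).symm
  have hseq : ∀ m : ℕ, (∫ z, h (z, KK (m+1) (MM P (m+1)) z) ∂lambdaMeasure) =
      ∫ w, f w ∂(muK P (m+1)) := by
    intro m
    unfold muK
    rw [integral_map (measurable_gr P _).aemeasurable hfm.aestronglyMeasurable]
    rfl
  simp_rw [hseq]
  rw [hlim, Metric.tendsto_atTop]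
  intro ε hε
  set A := (lambdaMeasure ⊗ₘ P).real (SS R) with hA
  have hA0 : 0 ≤ A := measureReal_nonneg
  obtain ⟨δ, hδ, H⟩ := huc (ε / (2 * A + 1)) (by positivity)
  obtain ⟨n0, hn0⟩ := cell_close hδ
  refine ⟨n0, fun m hm => ?_⟩
  have hpos : 0 < m + 1 := Nat.succ_pos m
  have hcl := hn0 (m+1) (by omega) hpos
  have : Nonempty (D × Angle) := ⟨((0, angOf 0), angOf 0)⟩
  let G : ℤ × ℕ × ℕ → ℝ := fun c => f (Function.invFun (phi (m+1)) c)
  have hG : ∀ w, |f w - G (phi (m+1) w)| ≤ ε / (2 * A + 1) := by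
    intro w
    have hw : phi (m+1) (Function.invFun (phi (m+1)) (phi (m+1) w)) = phi (m+1) w :=
      Function.invFun_eq ⟨w, rfl⟩
    change |f w - f (Function.invFun (phi (m+1)) (phi (m+1) w))| ≤ _
    generalize Function.invFun (phi (m+1)) (phi (m+1) w) = w' at hw
    simp only [phi, Prod.mk.injEq] at hw
    obtain ⟨e1, e2, e3⟩ := hw
    rw [← Real.dist_eq]
    apply le_of_lt
    apply H
    rw [Prod.dist_eq, max_lt_iff]
    exact ⟨hcl _ _ e1.symm e2.symm, hcl (w.1.1, w.2) (w'.1.1, w'.2) e1.symm e3.symm⟩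
  have hGC : ∀ c, |G c| ≤ C := fun c => hCf _
  have hmu : (muK P (m+1)).real (SS R) = A := by
    rw [hA, Measure.real, Measure.real, SS_muK P hsym hpos]
  have b1 := half_bound (muK P (m+1)) hpos f (by rw [SS_muK P hsym hpos]; exact SS_meas P R)
    hfm hCf hR G hG hGC
  have b2 := half_bound (lambdaMeasure ⊗ₘ P) hpos f (SS_meas P R) hfm hCf hR G hG hGC
  rw [map_phi P hsym hpos, hmu] at b1
  rw [← hA] at b2
  have hb : ε / (2 * A + 1) * A + ε / (2 * A + 1) * A < ε := by
    have : ε / (2 * A + 1) * (2 * A + 1) = ε := div_mul_cancel₀ _ (by positivity)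
    have h2 : 0 < ε / (2 * A + 1) := by positivity
    nlinarith
  rw [Real.dist_eq, abs_lt]
  rw [abs_le] at b1 b2
  constructor <;> linarith [b1.1, b1.2, b2.1, b2.2]

end Refl

/-- First step of the proof of Theorem 2.4: a random reflector `P̃` satisfying the angular
symmetry condition can be weakly approximated by simple symmetric functions. -/
theorem exists_simpleSymmetric_approx
    (Ptilde : Kernel D Angle) [IsMarkovKernel Ptilde]
    (hsym : ∀ᵐ x ∂(volume : Measure ℝ),
      (angularJoint Ptilde x).map Prod.swap = angularJoint Ptilde x) :
    ∃ K : ℕ → D → D, (∀ m, IsSimpleSymmetric (K m)) ∧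
      ∀ h : D × D → ℝ, Continuous h → HasCompactSupport h →
        Tendsto (fun m => ∫ z, h (z, K m z) ∂lambdaMeasure) atTop
          (nhds (∫ z, ∫ β, h (z, (z.1, β)) ∂(Ptilde z) ∂lambdaMeasure)) := by
  exact ⟨fun m => Refl.KK (m+1) (Refl.MM Ptilde (m+1)),
    fun m => Refl.simple (Refl.good Ptilde hsym (Nat.succ_pos m)),
    fun h hc hs => Refl.main_conv Ptilde hsym h hc hs⟩

end
end
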